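/- Let α ∈ (1/2, 1/√2), let δ_α = 1/4 − α/(2√2), and let R₀ = [−2,2]×[−√2,√2] ⊂ ℝ². Then F₁(S_α) ⊆ F₁(R₀) ⊆ {x ∈ ℝ² : x₁ ≥ 4δ_α} and F₂(S_α) ⊆ F₂(R₀) ⊆ {x ∈ ℝ² : x₁ ≤ −4δ_α}. -/

import Mathlib

open Set

noncomputable section

/-- Rotation by `π/2` about the origin. -/
def Rot (x : ℝ × ℝ) : ℝ × ℝ := (-x.2, x.1)

/-- The affine map `F₁ x = (1,0) + α R x`. -/
def F1 (α : ℝ) (x : ℝ × ℝ) : ℝ × ℝ := ((1 : ℝ), 0) + α • Rot x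

/-- The affine map `F₂ x = (-1,0) + α R x`. -/
def F2 (α : ℝ) (x : ℝ × ℝ) : ℝ × ℝ := ((-1 : ℝ), 0) + α • Rot x

/-- `F₁` or `F₂`, indexed by a letter of the alphabet `{1, 2}` (as a `Bool`,
`true ↦ F₁`, `false ↦ F₂`). -/
def Fb (α : ℝ) (b : Bool) : ℝ × ℝ → ℝ × ℝ := if b then F1 α else F2 α

/-- For a finite word `w = (w₁, …, w_k)` (a `List Bool`), the composition
`F_w = F_{w₁} ∘ … ∘ F_{w_k}`; the empty word gives the identity. -/
def Fw (α : ℝ) (w : List Bool) : ℝ × ℝ → ℝ × ℝ :=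
  w.foldr (fun b f => Fb α b ∘ f) id

/-- The segment `I = [-1,1] × {0}`. -/
def ISeg : Set (ℝ × ℝ) := Icc (-1 : ℝ) 1 ×ˢ ({0} : Set ℝ)

/-- The inhomogeneous self-similar set `S_α`: the closure of the union of the images
of `I` under all the maps `F_w`, `w` a finite word in `{1,2}`. -/
def Sset (α : ℝ) : Set (ℝ × ℝ) := closure (⋃ w : List Bool, Fw α w '' ISeg)


/-- The rectangle `R₀ = [-2,2] × [-√2,√2]`. -/
def R0 : Set (ℝ × ℝ) := Icc (-2 : ℝ) 2 ×ˢ Icc (-(Real.sqrt 2)) (Real.sqrt 2)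

theorem mul_sqrt_two_lt_one {α : ℝ} (hα : α < (Real.sqrt 2)⁻¹) : α * Real.sqrt 2 < 1 := by
  rwa [← one_div, lt_div_iff₀ (by positivity)] at hα

theorem mapsTo_Fb_R0 {α : ℝ} (h0 : 0 ≤ α) (h1 : α * Real.sqrt 2 ≤ 1) (b : Bool) :
    MapsTo (Fb α b) R0 R0 := by
  rintro ⟨x, y⟩ ⟨⟨hx, hx'⟩, hy, hy'⟩
  have hs : Real.sqrt 2 * Real.sqrt 2 = 2 := Real.mul_self_sqrt (by norm_num)
  have hs0 := Real.sqrt_nonneg 2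
  have hα : α * 2 ≤ Real.sqrt 2 := by nlinarith
  simp only at hx hx' hy hy'
  have hxl := mul_le_mul_of_nonneg_left hx h0
  have hxu := mul_le_mul_of_nonneg_left hx' h0
  have hyl := mul_le_mul_of_nonneg_left hy h0
  have hyu := mul_le_mul_of_nonneg_left hy' h0
  cases b <;> simp only [Fb, F1, F2, Rot, R0, mem_prod, mem_Icc, Prod.smul_mk, Prod.mk_add_mk,
    smul_eq_mul, if_true, Bool.false_eq_true, if_false] <;>
    refine ⟨⟨?_, ?_⟩, ?_, ?_⟩ <;> linarith

theorem mapsTo_Fw_R0 {α : ℝ} (h0 : 0 ≤ α) (h1 : α * Real.sqrt 2 ≤ 1) (w : List Bool) :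
    MapsTo (Fw α w) R0 R0 := by
  induction w with
  | nil => exact mapsTo_id R0
  | cons b w ih => exact (mapsTo_Fb_R0 h0 h1 b).comp ih

theorem ISeg_subset_R0 : ISeg ⊆ R0 :=
  prod_mono (Icc_subset_Icc (by norm_num) (by norm_num))
    (by simp [Real.sqrt_nonneg])

theorem isClosed_R0 : IsClosed R0 :=
  isClosed_Icc.prod isClosed_Icc

theorem Sset_subset_R0 {α : ℝ} (h0 : 0 ≤ α) (h1 : α * Real.sqrt 2 ≤ 1) : Sset α ⊆ R0 :=
  closure_minimal
    (iUnion_subset fun w => ((mapsTo_Fw_R0 h0 h1 w).mono_left ISeg_subset_R0).image_subset)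
    isClosed_R0

/-- For `α ∈ (1/2, 1/√2)` and `δ_α = 1/4 - α/(2√2)`:
`F₁(S_α) ⊆ F₁(R₀) ⊆ {x : x₁ ≥ 4δ_α}` and `F₂(S_α) ⊆ F₂(R₀) ⊆ {x : x₁ ≤ -4δ_α}`. -/
theorem statement10 (α : ℝ) (hα : α ∈ Ioo (1/2 : ℝ) (Real.sqrt 2)⁻¹)
    (δ : ℝ) (hδ : δ = 1/4 - α / (2 * Real.sqrt 2)) :
    F1 α '' Sset α ⊆ F1 α '' R0 ∧
    F1 α '' R0 ⊆ {x : ℝ × ℝ | 4 * δ ≤ x.1} ∧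
    F2 α '' Sset α ⊆ F2 α '' R0 ∧
    F2 α '' R0 ⊆ {x : ℝ × ℝ | x.1 ≤ -(4 * δ)} := by
  have h0 : 0 ≤ α := by linarith [hα.1]
  have h1 := (mul_sqrt_two_lt_one hα.2).le
  have hS := Sset_subset_R0 h0 h1
  have hδ' : 4 * δ = 1 - α * Real.sqrt 2 := by
    have hs : Real.sqrt 2 ^ 2 = 2 := Real.sq_sqrt (by norm_num)
    rw [hδ]
    field_simp
    linear_combination 2 * α * hs
  refine ⟨image_mono hS, ?_, image_mono hS, ?_⟩
  · rintro _ ⟨⟨x, y⟩, ⟨-, -, hy⟩, rfl⟩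
    have := mul_le_mul_of_nonneg_left hy h0
    simp only [F1, Rot, mem_ofPred_eq, Prod.smul_mk, Prod.mk_add_mk, smul_eq_mul] at this ⊢
    linarith
  · rintro _ ⟨⟨x, y⟩, ⟨-, hy, -⟩, rfl⟩
    have := mul_le_mul_of_nonneg_left hy h0
    simp only [F2, Rot, mem_ofPred_eq, Prod.smul_mk, Prod.mk_add_mk, smul_eq_mul] at this ⊢
    linarith

end
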